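/- arXiv:2005.09158 — 3 statements merged into one kernel-verified Lean document; each statement's English description precedes it below -/
import Mathlib

section
/- Let τ > 1, Δt_1 > 0 and Δt_n = Δt_1 τ^{n−1} for n = 1,…,N_t (geometrically increasing step sizes), and let B = B_1 be the Backward-Euler time-stepping matrix (the θ-method matrix B_2^{-1}B_1 with θ = 1). Then B = V D V^{-1}, where D = diag(1/Δt_1, …, 1/Δt_{N_t}), V is the unit lower triangular Toeplitz matrix with entries V_{jk} = p_{j−k} for j ≥ k, given by p_0 = 1 and p_n = 1/∏_{j=1}^{n}(1 − τ^j) for n ≥ 1, and V^{-1} is the unit lower triangular Toeplitz matrix with entries (V^{-1})_{jk} = q_{j−k} for j ≥ k, given by q_0 = 1 and q_n = (−1)^n τ^{n(n−1)/2} p_n for n ≥ 1. -/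
open Matrix Finset

/-- The Backward-Euler time-discretization matrix `B₁`: lower bidiagonal with
`(B₁)_{nn} = 1/Δtₙ` and `(B₁)_{n,n-1} = -1/Δtₙ` (0-based indices). -/
noncomputable def timeMatB1 (Nt : ℕ) (dt : Fin Nt → ℝ) : Matrix (Fin Nt) (Fin Nt) ℝ :=
  Matrix.of fun j k =>
    if j = k then 1 / dt j else if (j : ℕ) = (k : ℕ) + 1 then -(1 / dt j) else 0

/-- The unit lower triangular Toeplitz matrix with entries `p_{j-k}` for `j ≥ k`. -/
noncomputable def lowerToeplitz (Nt : ℕ) (p : ℕ → ℝ) : Matrix (Fin Nt) (Fin Nt) ℝ :=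
  Matrix.of fun j k => if (k : ℕ) ≤ (j : ℕ) then p ((j : ℕ) - (k : ℕ)) else 0

theorem timeMatB1_mul_apply_zero (Nt : ℕ) (dt : Fin Nt → ℝ) (M : Matrix (Fin Nt) (Fin Nt) ℝ)
    (j k : Fin Nt) (hj : (j : ℕ) = 0) :
    (timeMatB1 Nt dt * M) j k = 1 / dt j * M j k := by
  rw [Matrix.mul_apply, Finset.sum_eq_single j]
  · simp [timeMatB1]
  · intro l _ hl
    simp [timeMatB1, Ne.symm hl, hj]
  · simp

theorem timeMatB1_mul_apply_succ (Nt : ℕ) (dt : Fin Nt → ℝ) (M : Matrix (Fin Nt) (Fin Nt) ℝ)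
    (j l k : Fin Nt) (hj : (j : ℕ) = l + 1) :
    (timeMatB1 Nt dt * M) j k = 1 / dt j * (M j k - M l k) := by
  have hjl : j ≠ l := by
    rintro rfl
    omega
  rw [Matrix.mul_apply, Finset.sum_eq_add j l hjl]
  · simp only [timeMatB1, Matrix.of_apply, if_true, if_neg hjl, if_pos hj]
    ring
  · rintro i _ ⟨hij, hil⟩
    have : (j : ℕ) ≠ i + 1 := fun h => hil (Fin.ext (by omega))
    simp [timeMatB1, Ne.symm hij, this]
  · simp
  · simp

theorem mul_timeMatB1_apply_last (Nt : ℕ) (dt : Fin Nt → ℝ) (M : Matrix (Fin Nt) (Fin Nt) ℝ)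
    (j k : Fin Nt) (hk : (k : ℕ) + 1 = Nt) :
    (M * timeMatB1 Nt dt) j k = M j k * (1 / dt k) := by
  rw [Matrix.mul_apply, Finset.sum_eq_single k]
  · simp [timeMatB1]
  · intro l _ hl
    have : (l : ℕ) ≠ k + 1 := by omega
    simp [timeMatB1, hl, this]
  · simp

theorem mul_timeMatB1_apply_succ (Nt : ℕ) (dt : Fin Nt → ℝ) (M : Matrix (Fin Nt) (Fin Nt) ℝ)
    (j k l : Fin Nt) (hl : (l : ℕ) = k + 1) :
    (M * timeMatB1 Nt dt) j k = M j k * (1 / dt k) - M j l * (1 / dt l) := by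
  have hkl : l ≠ k := by
    rintro rfl
    omega
  rw [Matrix.mul_apply, Finset.sum_eq_add k l hkl.symm]
  · simp only [timeMatB1, Matrix.of_apply, if_true, if_neg hkl, if_pos hl]
    ring
  · rintro i _ ⟨hik, hil⟩
    have : (i : ℕ) ≠ k + 1 := fun h => hil (Fin.ext (by omega))
    simp [timeMatB1, hik, this]
  · simp
  · simp

theorem timeMatB1_mul_lowerToeplitz (Nt : ℕ) (τ a : ℝ) (hτ : τ ≠ 0) (p : ℕ → ℝ)
    (hp : ∀ n, p (n + 1) * (1 - τ ^ (n + 1)) = p n) :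
    timeMatB1 Nt (fun n => a * τ ^ (n : ℕ)) * lowerToeplitz Nt p =
      lowerToeplitz Nt p * Matrix.diagonal fun n : Fin Nt => 1 / (a * τ ^ (n : ℕ)) := by
  ext j k
  rw [Matrix.mul_diagonal]
  obtain hj | ⟨m, hm⟩ : (j : ℕ) = 0 ∨ ∃ m, (j : ℕ) = m + 1 := by
    rcases (j : ℕ) with _ | m
    · exact Or.inl rfl
    · exact Or.inr ⟨m, rfl⟩
  · rw [timeMatB1_mul_apply_zero _ _ _ _ _ hj]
    by_cases hk : (k : ℕ) = 0
    · simp [hj, hk, mul_comm]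
    · have : ¬ k ≤ j := fun h => hk (by have := Fin.le_def.mp h; omega)
      simp [lowerToeplitz, this]
  · rw [timeMatB1_mul_apply_succ _ _ _ j ⟨m, by omega⟩ _ hm]
    simp only [lowerToeplitz, Matrix.of_apply]
    by_cases h1 : (k : ℕ) ≤ m
    · obtain ⟨i, rfl⟩ := Nat.exists_eq_add_of_le h1
      have hsub : (j : ℕ) - k = i + 1 := by omega
      rw [if_pos (by omega), if_pos h1, hsub, Nat.add_sub_cancel_left, ← hp i, hm,
        show (k : ℕ) + i + 1 = k + (i + 1) by ring, pow_add τ (k : ℕ)]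
      field_simp
      ring
    · by_cases h2 : (k : ℕ) = m + 1
      · simp [hm, h2, mul_comm]
      · rw [if_neg (by omega), if_neg h1]
        simp

theorem lowerToeplitz_mul_timeMatB1 (Nt : ℕ) (τ a : ℝ) (hτ : τ ≠ 0) (q : ℕ → ℝ)
    (hq : ∀ n, q (n + 1) * (1 - τ ^ (n + 1)) = -(τ ^ n * q n)) :
    lowerToeplitz Nt q * timeMatB1 Nt (fun n => a * τ ^ (n : ℕ)) =
      (Matrix.diagonal fun n : Fin Nt => 1 / (a * τ ^ (n : ℕ))) * lowerToeplitz Nt q := by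
  ext j k
  rw [Matrix.diagonal_mul]
  by_cases hk : (k : ℕ) + 1 = Nt
  · rw [mul_timeMatB1_apply_last _ _ _ _ _ hk]
    by_cases hjk : j = k
    · subst hjk
      ring
    · have : ¬ k ≤ j := fun h => hjk (Fin.ext (by have := Fin.le_def.mp h; omega))
      simp [lowerToeplitz, this]
  · rw [mul_timeMatB1_apply_succ _ _ _ _ k ⟨k + 1, by omega⟩ rfl]
    simp only [lowerToeplitz, Matrix.of_apply]
    by_cases h1 : (k : ℕ) + 1 ≤ j
    · obtain ⟨i, hi⟩ := Nat.exists_eq_add_of_le h1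
      have hsub : (j : ℕ) - k = i + 1 := by omega
      have hsub' : (j : ℕ) - (k + 1) = i := by omega
      rw [if_pos (by omega), if_pos h1, hsub, hsub', hi]
      have hqi : τ ^ i * q i = q (i + 1) * (τ ^ (i + 1) - 1) := by linarith [hq i]
      rw [show (k : ℕ) + 1 + i = k + 1 + i from rfl, pow_add τ ((k : ℕ) + 1) i, pow_succ]
      rw [pow_succ] at hqi
      rcases eq_or_ne a 0 with rfl | ha
      · simp
      · field_simp
        linarith
    · rw [if_neg h1]
      by_cases h2 : (j : ℕ) = k
      · simp [h2, mul_comm]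
      · rw [if_neg (by omega)]
        simp

theorem lowerToeplitz_mul_apply_self (Nt : ℕ) (p q : ℕ → ℝ) (j : Fin Nt) :
    (lowerToeplitz Nt q * lowerToeplitz Nt p) j j = q 0 * p 0 := by
  rw [Matrix.mul_apply, Finset.sum_eq_single j]
  · simp [lowerToeplitz]
  · intro l _ hl
    simp only [lowerToeplitz, Matrix.of_apply]
    by_cases h : (l : ℕ) ≤ j
    · have : ¬ (j : ℕ) ≤ l := fun h' => hl (Fin.ext (by omega))
      simp [this]
    · simp [h]
  · simp

/-- A matrix with unit diagonal commuting with a diagonal matrix with distinct entries is the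
identity. -/
theorem eq_one_of_mul_diagonal_comm {n : Type*} [Fintype n] [DecidableEq n] (M : Matrix n n ℝ)
    (d : n → ℝ) (hd : Function.Injective d)
    (h : M * Matrix.diagonal d = Matrix.diagonal d * M) (hM : ∀ i, M i i = 1) : M = 1 := by
  ext i j
  by_cases hij : i = j
  · subst hij
    simp [hM]
  · have e := congrFun (congrFun h i) j
    rw [Matrix.mul_diagonal, Matrix.diagonal_mul] at e
    have e' : M i j * (d j - d i) = 0 := by linarith
    rw [Matrix.one_apply_ne hij]
    exact (mul_eq_zero.mp e').resolve_right (sub_ne_zero.mpr fun h' => hij (hd h').symm)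

/-- Diagonalization of the Backward-Euler time-stepping matrix with geometrically
increasing step sizes `Δtₙ = Δt₁ τ^{n-1}`:  `B = V D V⁻¹`, where
`D = diag(1/Δt₁, …, 1/Δt_{N_t})`, `V` is the unit lower triangular Toeplitz matrix built
from `p₀ = 1`, `pₙ = 1/∏_{j=1}^n (1-τ^j)`, and `V⁻¹` is the one built from
`q₀ = 1`, `qₙ = (-1)^n τ^{n(n-1)/2} pₙ`. -/
theorem backwardEuler_geometric_diagonalization (Nt : ℕ) (hNt : 1 ≤ Nt)
    (τ Δt₁ : ℝ) (hτ : 1 < τ) (hΔt₁ : 0 < Δt₁) :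
    let dt : Fin Nt → ℝ := fun n => Δt₁ * τ ^ (n : ℕ)
    let p : ℕ → ℝ := fun n => (∏ j ∈ Finset.Icc 1 n, (1 - τ ^ j))⁻¹
    let q : ℕ → ℝ := fun n => (-1) ^ n * τ ^ (n * (n - 1) / 2) * p n
    let V := lowerToeplitz Nt p
    let W := lowerToeplitz Nt q
    let D := Matrix.diagonal fun n => 1 / dt n
    V * W = 1 ∧ W * V = 1 ∧ timeMatB1 Nt dt = V * D * W := by
  intro dt p q V W D
  have hτ0 : τ ≠ 0 := by positivity
  have hp : ∀ n, p (n + 1) * (1 - τ ^ (n + 1)) = p n := by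
    intro n
    have hne : 1 - τ ^ (n + 1) ≠ 0 := by
      have : 1 < τ ^ (n + 1) := one_lt_pow₀ hτ n.succ_ne_zero
      exact ne_of_lt (by linarith)
    simp only [p]
    rw [Finset.prod_Icc_succ_top (by omega), mul_inv, mul_assoc, inv_mul_cancel₀ hne, mul_one]
  have hq : ∀ n, q (n + 1) * (1 - τ ^ (n + 1)) = -(τ ^ n * q n) := by
    intro n
    have he : (n + 1) * (n + 1 - 1) / 2 = n * (n - 1) / 2 + n := by
      rw [← Finset.sum_range_id_mul_two, ← Finset.sum_range_id_mul_two, Finset.sum_range_succ]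
      omega
    change (-1) ^ (n + 1) * τ ^ ((n + 1) * (n + 1 - 1) / 2) * p (n + 1) * (1 - τ ^ (n + 1)) =
      -(τ ^ n * ((-1) ^ n * τ ^ (n * (n - 1) / 2) * p n))
    rw [he, mul_assoc, hp, pow_add, pow_succ]
    ring
  have hBV : timeMatB1 Nt dt * V = V * D := timeMatB1_mul_lowerToeplitz Nt τ Δt₁ hτ0 p hp
  have hWB : W * timeMatB1 Nt dt = D * W := lowerToeplitz_mul_timeMatB1 Nt τ Δt₁ hτ0 q hq
  have hinj : Function.Injective fun n => 1 / dt n := by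
    intro i j hij
    have h : dt i = dt j := by simpa using hij
    exact Fin.ext (pow_right_injective₀ (by linarith) hτ.ne' (mul_left_cancel₀ hΔt₁.ne' h))
  have hWV : W * V = 1 := by
    refine eq_one_of_mul_diagonal_comm _ _ hinj ?_ fun j => ?_
    · change W * V * D = D * (W * V)
      rw [Matrix.mul_assoc, ← hBV, ← Matrix.mul_assoc, hWB, Matrix.mul_assoc]
    · rw [lowerToeplitz_mul_apply_self]
      simp [p, q]
  have hVW : V * W = 1 := mul_eq_one_comm.mp hWV
  exact ⟨hVW, hWV, by rw [← hBV, Matrix.mul_assoc, hVW, Matrix.mul_one]⟩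
end

section
/- There exists a constant C > 0 such that for every N_t ≥ 8 the following holds: let x_1, …, x_{N_t} be the N_t pairwise distinct roots of q(x) = U_{N_t−1}(x) − i·T_{N_t}(x), and let V ∈ ℂ^{N_t×N_t} be the eigenvector matrix whose n-th column is v_n = (i^l U_l(x_n))_{l=0}^{N_t−1}. Then V is invertible and Cond₂(V) ≤ C·N_t². -/
open Matrix Polynomial

/-- The spectral norm (largest singular value) of a complex matrix, realized as the
operator norm of the associated linear map on Euclidean space. -/
noncomputable def spectralNorm2 {N : ℕ} (M : Matrix (Fin N) (Fin N) ℂ) : ℝ :=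
  ‖LinearMap.toContinuousLinearMap (Matrix.toEuclideanLin M)‖

/-- The 2-condition number `Cond₂(V) = ‖V‖₂ ‖V⁻¹‖₂`. -/
noncomputable def cond2 {N : ℕ} (M : Matrix (Fin N) (Fin N) ℂ) : ℝ :=
  spectralNorm2 M * spectralNorm2 M⁻¹

namespace HybridTime

/-! ### Spectral and Frobenius norms -/

/-- The sum of the squared moduli of the entries. -/
noncomputable def frobSq {N : ℕ} (M : Matrix (Fin N) (Fin N) ℂ) : ℝ :=
  ∑ i, ∑ j, ‖M i j‖ ^ 2

lemma spectralNorm2_le_sqrt_frobSq {N : ℕ} (M : Matrix (Fin N) (Fin N) ℂ) :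
    spectralNorm2 M ≤ √(frobSq M) := by
  refine ContinuousLinearMap.opNorm_le_bound _ (Real.sqrt_nonneg _) fun v => ?_
  rw [EuclideanSpace.norm_eq, EuclideanSpace.norm_eq, ← Real.sqrt_mul' _ (by positivity)]
  refine Real.sqrt_le_sqrt ?_
  rw [frobSq, Finset.sum_mul]
  refine Finset.sum_le_sum fun i _ => ?_
  calc ‖∑ j, M i j * v j‖ ^ 2 ≤ (∑ j, ‖M i j‖ * ‖v j‖) ^ 2 := by
        gcongr
        exact (norm_sum_le _ _).trans_eq (by simp)
    _ ≤ _ := Finset.sum_mul_sq_le_sq_mul_sq _ _ _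

/-! ### Identities for Chebyshev polynomials -/

section Identities

variable {R : Type*} [CommRing R]

lemma U_sq_sub_mul_add_sq (x : R) (n : ℕ) :
    (Chebyshev.U R n).eval x ^ 2 - 2 * x * (Chebyshev.U R n).eval x *
      (Chebyshev.U R ((n : ℤ) - 1)).eval x + (Chebyshev.U R ((n : ℤ) - 1)).eval x ^ 2 = 1 := by
  induction n with
  | zero => simp
  | succ n ih =>
    have h := congrArg (eval x) (Chebyshev.U_add_one R n)
    simp only [eval_sub, eval_mul, eval_ofNat, eval_X] at h
    push_cast
    rw [add_sub_cancel_right, h]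
    linear_combination ih

lemma christoffelDarboux (x y : R) (n : ℕ) :
    2 * (x - y) * ∑ l ∈ Finset.range n, (Chebyshev.U R l).eval x * (Chebyshev.U R l).eval y =
      (Chebyshev.U R n).eval x * (Chebyshev.U R ((n : ℤ) - 1)).eval y -
        (Chebyshev.U R ((n : ℤ) - 1)).eval x * (Chebyshev.U R n).eval y := by
  induction n with
  | zero => simp
  | succ n ih =>
    have hx := congrArg (eval x) (Chebyshev.U_add_one R n)
    have hy := congrArg (eval y) (Chebyshev.U_add_one R n)
    simp only [eval_sub, eval_mul, eval_ofNat, eval_X] at hx hy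
    rw [Finset.sum_range_succ, mul_add, ih]
    push_cast
    rw [add_sub_cancel_right, hx, hy]
    ring

lemma eval_T_eq (x : R) (n : ℕ) : (Chebyshev.T R n).eval x =
    (Chebyshev.U R n).eval x - x * (Chebyshev.U R ((n : ℤ) - 1)).eval x := by
  simpa using congrArg (eval x) (Chebyshev.T_eq_U_sub_X_mul_U R n)

lemma T_sq_sub_mul_U_sq (x : R) (n : ℕ) : (Chebyshev.T R n).eval x ^ 2 +
    (1 - x ^ 2) * (Chebyshev.U R ((n : ℤ) - 1)).eval x ^ 2 = 1 := by
  rw [eval_T_eq]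
  linear_combination U_sq_sub_mul_add_sq x n

lemma sum_U_sq (x : R) (n : ℕ) :
    (1 - x ^ 2) * (2 * ∑ l ∈ Finset.range n, (Chebyshev.U R l).eval x ^ 2 -
      (Chebyshev.U R ((n : ℤ) - 1)).eval x ^ 2) =
      n - x * (Chebyshev.U R ((n : ℤ) - 1)).eval x * (Chebyshev.T R n).eval x := by
  induction n with
  | zero => simp
  | succ n ih =>
    have hp := U_sq_sub_mul_add_sq x n
    have h := congrArg (eval x) (Chebyshev.U_add_one R n)
    simp only [eval_sub, eval_mul, eval_ofNat, eval_X] at h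
    rw [eval_T_eq] at ih
    rw [Finset.sum_range_succ, eval_T_eq]
    push_cast
    rw [add_sub_cancel_right, h]
    linear_combination ih + hp

lemma natCast_mul_eval_T (x : R) (n : ℕ) : n * (Chebyshev.T R n).eval x =
    x * (Chebyshev.U R ((n : ℤ) - 1)).eval x -
      (1 - x ^ 2) * (derivative (Chebyshev.U R ((n : ℤ) - 1))).eval x := by
  have h := congrArg (eval x) (Chebyshev.add_one_mul_T_eq_poly_in_U (R := R) ((n : ℤ) - 1))
  simpa using h

end Identities

/-! ### Bounds off the real axis -/

lemma norm_cos_sq (z : ℂ) : ‖Complex.cos z‖ ^ 2 = Real.cos z.re ^ 2 + Real.sinh z.im ^ 2 := by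
  rw [← Complex.normSq_eq_norm_sq, Complex.cos_eq, Complex.normSq_apply]
  simp [← Complex.ofReal_cos, ← Complex.ofReal_sin, ← Complex.ofReal_cosh, ← Complex.ofReal_sinh]
  nlinarith [Real.cosh_sq z.im, Real.sin_sq_add_cos_sq z.re]

lemma norm_sin_sq (z : ℂ) : ‖Complex.sin z‖ ^ 2 = Real.sin z.re ^ 2 + Real.sinh z.im ^ 2 := by
  rw [← Complex.normSq_eq_norm_sq, Complex.sin_eq, Complex.normSq_apply]
  simp [← Complex.ofReal_cos, ← Complex.ofReal_sin, ← Complex.ofReal_cosh, ← Complex.ofReal_sinh]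
  nlinarith [Real.cosh_sq z.im, Real.sin_sq_add_cos_sq z.re]

lemma sinh_natCast_mul_sq_mono (b : ℝ) {j n : ℕ} (h : j ≤ n) :
    Real.sinh (j * b) ^ 2 ≤ Real.sinh (n * b) ^ 2 := by
  rw [sq_le_sq, Real.abs_sinh, Real.abs_sinh, Real.sinh_le_sinh, abs_mul, abs_mul]
  gcongr

lemma norm_U_sq_mul_le (x : ℂ) {l n : ℕ} (h : l < n) :
    ‖(Chebyshev.U ℂ l).eval x‖ ^ 2 * ‖1 - x ^ 2‖ ≤ 1 + ‖(Chebyshev.T ℂ n).eval x‖ ^ 2 := by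
  obtain ⟨θ, rfl⟩ := Complex.cos_surjective x
  have h1 : 1 - Complex.cos θ ^ 2 = Complex.sin θ ^ 2 := by
    linear_combination -Complex.sin_sq_add_cos_sq θ
  have hU := Chebyshev.U_complex_cos θ l
  have hT := Chebyshev.T_complex_cos θ n
  rw [h1, norm_pow, ← mul_pow, ← norm_mul, hU, hT, norm_cos_sq, norm_sin_sq]
  have := sinh_natCast_mul_sq_mono θ.im (Nat.succ_le_of_lt h)
  simp at this ⊢
  nlinarith [Real.sin_sq_le_one ((l + 1) * θ.re), sq_nonneg (Real.cos (n * θ.re))]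

lemma norm_T_le_exp (x : ℂ) (n : ℕ) : ‖(Chebyshev.T ℂ n).eval x‖ ≤ Real.exp (n * ‖x‖) := by
  obtain ⟨θ, rfl⟩ := Complex.cos_surjective x
  have hb : |θ.im| ≤ ‖Complex.cos θ‖ := by
    have h1 : |θ.im| ≤ Real.sinh |θ.im| := Real.self_le_sinh_iff.2 (abs_nonneg _)
    refine h1.trans (le_of_sq_le_sq ?_ (norm_nonneg _))
    rw [norm_cos_sq, ← Real.abs_sinh, sq_abs]
    nlinarith [sq_nonneg (Real.cos θ.re)]
  have hT : ‖(Chebyshev.T ℂ n).eval (Complex.cos θ)‖ ^ 2 = _ :=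
    congrArg (‖·‖ ^ 2) (Chebyshev.T_complex_cos θ n)
  rw [norm_cos_sq] at hT
  have him : ((n : ℤ) * θ : ℂ).im = n * θ.im := by simp
  calc ‖(Chebyshev.T ℂ n).eval (Complex.cos θ)‖ ≤ Real.cosh (n * θ.im) := by
        refine le_of_sq_le_sq ?_ (Real.cosh_pos _).le
        rw [hT, him, Real.cosh_sq]
        nlinarith [Real.cos_sq_le_one ((n : ℤ) * θ : ℂ).re]
    _ ≤ Real.exp |n * θ.im| := by
        rw [← Real.cosh_abs, Real.cosh_eq]
        have : Real.exp (-|n * θ.im|) ≤ Real.exp |n * θ.im| :=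
          Real.exp_le_exp.2 (by linarith [abs_nonneg (n * θ.im)])
        linarith
    _ ≤ _ := by
        rw [abs_mul, Nat.abs_cast]
        gcongr

lemma one_lt_norm_T {x : ℂ} (hx : 2 ≤ ‖x‖) {n : ℕ} (hn : 1 ≤ n) :
    1 < ‖(Chebyshev.T ℂ n).eval x‖ := by
  obtain ⟨θ, rfl⟩ := Complex.cos_surjective x
  have h1 : 2 ^ 2 ≤ ‖Complex.cos θ‖ ^ 2 := by gcongr
  have h2 := sinh_natCast_mul_sq_mono θ.im hn
  have hT : ‖(Chebyshev.T ℂ n).eval (Complex.cos θ)‖ ^ 2 = _ :=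
    congrArg (‖·‖ ^ 2) (Chebyshev.T_complex_cos θ n)
  rw [norm_cos_sq] at h1 hT
  refine lt_of_pow_lt_pow_left₀ 2 (norm_nonneg _) ?_
  rw [hT]
  simp at h2 ⊢
  nlinarith [Real.cos_sq_le_one θ.re, sq_nonneg (Real.cos (n * θ.re))]

/-! ### The roots of `U_{N-1} - i T_N` -/

/-- The characteristic polynomial `U_{N-1} - i T_N`. -/
noncomputable def hybridPoly (N : ℕ) : ℂ[X] :=
  Chebyshev.U ℂ ((N : ℤ) - 1) - Polynomial.C Complex.I * Chebyshev.T ℂ (N : ℤ)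

section Root

variable {N : ℕ} {x : ℂ}

lemma eval_hybridPoly (N : ℕ) (x : ℂ) : (hybridPoly N).eval x =
    (Chebyshev.U ℂ ((N : ℤ) - 1)).eval x - Complex.I * (Chebyshev.T ℂ (N : ℤ)).eval x := by
  simp [hybridPoly]

lemma eval_derivative_hybridPoly (N : ℕ) (x : ℂ) : (derivative (hybridPoly N)).eval x =
    (derivative (Chebyshev.U ℂ ((N : ℤ) - 1))).eval x -
      Complex.I * (N * (Chebyshev.U ℂ ((N : ℤ) - 1)).eval x) := by
  simp [hybridPoly, Chebyshev.T_derivative_eq_U]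

lemma eval_U_of_root (h : (hybridPoly N).eval x = 0) :
    (Chebyshev.U ℂ ((N : ℤ) - 1)).eval x = Complex.I * (Chebyshev.T ℂ (N : ℤ)).eval x := by
  rw [eval_hybridPoly] at h
  linear_combination h

lemma eval_U_self_of_root (h : (hybridPoly N).eval x = 0) :
    (Chebyshev.U ℂ (N : ℤ)).eval x =
      (x - Complex.I) * (Chebyshev.U ℂ ((N : ℤ) - 1)).eval x := by
  have h1 := eval_U_of_root h
  linear_combination -(eval_T_eq x N) + Complex.I * h1 +
    (Chebyshev.T ℂ (N : ℤ)).eval x * Complex.I_mul_I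

lemma sq_mul_T_sq_of_root (h : (hybridPoly N).eval x = 0) :
    x ^ 2 * (Chebyshev.T ℂ (N : ℤ)).eval x ^ 2 = 1 := by
  have h1 := T_sq_sub_mul_U_sq x N
  rw [eval_U_of_root h] at h1
  linear_combination h1 + (1 - x ^ 2) * (Chebyshev.T ℂ (N : ℤ)).eval x ^ 2 * -Complex.I_sq

lemma norm_mul_norm_T_of_root (h : (hybridPoly N).eval x = 0) :
    ‖x‖ * ‖(Chebyshev.T ℂ (N : ℤ)).eval x‖ = 1 := by
  have h1 := congrArg norm (sq_mul_T_sq_of_root h)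
  rw [← mul_pow, norm_pow, norm_mul, norm_one] at h1
  exact (pow_eq_one_iff_of_nonneg (by positivity) two_ne_zero).1 h1

lemma ne_zero_of_root (h : (hybridPoly N).eval x = 0) : x ≠ 0 := by
  rintro rfl
  simpa using sq_mul_T_sq_of_root h

lemma norm_le_two_of_root (hN : 1 ≤ N) (h : (hybridPoly N).eval x = 0) : ‖x‖ ≤ 2 := by
  by_contra! hx
  have h1 := one_lt_norm_T hx.le hN
  nlinarith [norm_mul_norm_T_of_root h]

lemma exp_three_halves_lt : Real.exp (3 / 2) < 16 / 3 := by
  refine lt_of_pow_lt_pow_left₀ 2 (by norm_num) ?_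
  rw [← Real.exp_nat_mul]
  have h : Real.exp ((2 : ℕ) * (3 / 2)) = Real.exp 1 ^ 3 := by
    rw [← Real.exp_nat_mul]; norm_num
  rw [h]
  calc Real.exp 1 ^ 3 ≤ 2.7182818286 ^ 3 := by
        gcongr
        exact Real.exp_one_lt_d9.le
    _ < _ := by norm_num

lemma three_halves_le_of_root (hN : 8 ≤ N) (h : (hybridPoly N).eval x = 0) :
    3 / 2 ≤ N * ‖x‖ := by
  by_contra! hx
  have hN' : (8 : ℝ) ≤ N := by exact_mod_cast hN
  have h1 : ‖(Chebyshev.T ℂ N).eval x‖ < 16 / 3 :=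
    (norm_T_le_exp x N).trans_lt ((Real.exp_le_exp.2 hx.le).trans_lt exp_three_halves_lt)
  have h2 := norm_mul_norm_T_of_root h
  have h3 : (N : ℝ) = N * ‖x‖ * ‖(Chebyshev.T ℂ (N : ℤ)).eval x‖ := by
    rw [mul_assoc, h2, mul_one]
  nlinarith [norm_nonneg ((Chebyshev.T ℂ (N : ℤ)).eval x)]

/-- The bilinear square of an eigenvector with respect to the weights that make the hybrid
time-discretization matrix complex symmetric. -/
noncomputable def weightedSq (N : ℕ) (x : ℂ) : ℂ :=
  ∑ l ∈ Finset.range N, (Chebyshev.U ℂ l).eval x ^ 2 -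
    (Chebyshev.U ℂ ((N : ℤ) - 1)).eval x ^ 2 / 2

/-- The squared Euclidean norm of an eigenvector. -/
noncomputable def normSqSum (N : ℕ) (x : ℂ) : ℝ :=
  ∑ l ∈ Finset.range N, ‖(Chebyshev.U ℂ l).eval x‖ ^ 2

lemma mul_weightedSq_of_root (h : (hybridPoly N).eval x = 0) :
    2 * x * ((1 - x ^ 2) * weightedSq N x) = N * x - Complex.I := by
  have h1 := sum_U_sq x N
  rw [eval_U_of_root h] at h1
  rw [weightedSq, eval_U_of_root h]
  linear_combination x * h1 - Complex.I * sq_mul_T_sq_of_root h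

lemma norm_weightedSq_of_root (hN : 8 ≤ N) (h : (hybridPoly N).eval x = 0) :
    (N : ℝ) / 6 ≤ ‖1 - x ^ 2‖ * ‖weightedSq N x‖ := by
  have h1 := congrArg norm (mul_weightedSq_of_root h)
  have h2 := three_halves_le_of_root hN h
  have h3 : ‖(N : ℂ) * x‖ - ‖Complex.I‖ ≤ ‖N * x - Complex.I‖ := norm_sub_norm_le _ _
  have h4 : 0 < ‖x‖ := norm_pos_iff.2 (ne_zero_of_root h)
  simp only [norm_mul, Complex.norm_I, Complex.norm_natCast, Complex.norm_ofNat] at h1 h3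
  rw [← h1] at h3
  refine le_of_mul_le_mul_left (?_ : ‖x‖ * _ ≤ ‖x‖ * _) h4
  linarith

lemma norm_one_sub_sq_pos_of_root (hN : 8 ≤ N) (h : (hybridPoly N).eval x = 0) :
    0 < ‖1 - x ^ 2‖ := by
  have h1 := norm_weightedSq_of_root hN h
  have h2 : (8 : ℝ) ≤ N := by exact_mod_cast hN
  refine (norm_nonneg _).lt_of_ne fun h0 => ?_
  rw [← h0, zero_mul] at h1
  linarith

lemma sum_mul_eq_zero_of_roots {y : ℂ} (hx : (hybridPoly N).eval x = 0)
    (hy : (hybridPoly N).eval y = 0) (hxy : x ≠ y) :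
    ∑ l ∈ Finset.range N, (Chebyshev.U ℂ l).eval x * (Chebyshev.U ℂ l).eval y -
      (Chebyshev.U ℂ ((N : ℤ) - 1)).eval x * (Chebyshev.U ℂ ((N : ℤ) - 1)).eval y / 2 = 0 := by
  have h := christoffelDarboux x y N
  rw [eval_U_self_of_root hx, eval_U_self_of_root hy] at h
  refine (mul_eq_zero.1 (?_ : (x - y) * _ = 0)).resolve_left (sub_ne_zero.2 hxy)
  linear_combination h / 2

lemma eval_U_conj (n : ℤ) (x : ℂ) : (Chebyshev.U ℂ n).eval ((starRingEnd ℂ) x) =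
    (starRingEnd ℂ) ((Chebyshev.U ℂ n).eval x) := by
  have h := Polynomial.eval_map_apply (starRingEnd ℂ) (p := Chebyshev.U ℂ n) x
  rwa [Chebyshev.map_U] at h

lemma im_mul_of_root (h : (hybridPoly N).eval x = 0) :
    -x.im * (2 * normSqSum N x - ‖(Chebyshev.U ℂ ((N : ℤ) - 1)).eval x‖ ^ 2) =
      ‖(Chebyshev.U ℂ ((N : ℤ) - 1)).eval x‖ ^ 2 := by
  have h1 := christoffelDarboux x ((starRingEnd ℂ) x) N
  simp only [eval_U_conj, eval_U_self_of_root h, map_mul, map_sub, Complex.conj_I,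
    Complex.mul_conj', Complex.sub_conj] at h1
  have h2 := Complex.mul_conj' ((Chebyshev.U ℂ ((N : ℤ) - 1)).eval x)
  have h3 := Complex.sub_conj x
  apply Complex.ofReal_injective
  rw [normSqSum]
  push_cast at h1 h3 ⊢
  refine mul_left_cancel₀ (mul_ne_zero two_ne_zero Complex.I_ne_zero) ?_
  linear_combination -h1 - h2 * (x - Complex.I - ((starRingEnd ℂ) x + Complex.I)) +
    (‖(Chebyshev.U ℂ ((N : ℤ) - 1)).eval x‖ : ℂ) ^ 2 * -h3

end Root

section RootBounds

variable {N : ℕ} {x : ℂ}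

lemma norm_U_le_normSqSum (hN : 1 ≤ N) (x : ℂ) :
    ‖(Chebyshev.U ℂ ((N : ℤ) - 1)).eval x‖ ^ 2 ≤ normSqSum N x := by
  obtain ⟨m, rfl⟩ := Nat.exists_eq_add_of_le' hN
  rw [normSqSum, Finset.sum_range_succ]
  push_cast
  rw [add_sub_cancel_right]
  exact le_add_of_nonneg_left (by positivity)

lemma norm_U_of_root (h : (hybridPoly N).eval x = 0) :
    ‖x‖ * ‖(Chebyshev.U ℂ ((N : ℤ) - 1)).eval x‖ = 1 := by
  rw [eval_U_of_root h, norm_mul, Complex.norm_I, one_mul, norm_mul_norm_T_of_root h]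

lemma im_neg_of_root (hN : 1 ≤ N) (h : (hybridPoly N).eval x = 0) : 0 < -x.im := by
  have h1 := im_mul_of_root h
  have h2 := norm_U_le_normSqSum hN x
  have h3 : 0 < ‖(Chebyshev.U ℂ ((N : ℤ) - 1)).eval x‖ ^ 2 := by
    have := norm_U_of_root h
    have h0 : (Chebyshev.U ℂ ((N : ℤ) - 1)).eval x ≠ 0 := by
      intro h0
      simp [h0] at this
    positivity
  by_contra! hx
  nlinarith

/-- The squared norm of an eigenvector is at most `1 / (|x|² (-Im x))`. -/
lemma normSqSum_mul_le (hN : 1 ≤ N) (h : (hybridPoly N).eval x = 0) :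
    normSqSum N x * (‖x‖ ^ 2 * -x.im) ≤ 1 := by
  have h1 := im_mul_of_root h
  have h2 := norm_U_le_normSqSum hN x
  have h3 := im_neg_of_root hN h
  have h4 : ‖x‖ ^ 2 * ‖(Chebyshev.U ℂ ((N : ℤ) - 1)).eval x‖ ^ 2 = 1 := by
    rw [← mul_pow, norm_U_of_root h, one_pow]
  calc normSqSum N x * (‖x‖ ^ 2 * -x.im) = ‖x‖ ^ 2 * (-x.im * normSqSum N x) := by ring
    _ ≤ ‖x‖ ^ 2 * (-x.im *
        (2 * normSqSum N x - ‖(Chebyshev.U ℂ ((N : ℤ) - 1)).eval x‖ ^ 2)) := by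
      gcongr
      linarith
    _ = 1 := by rw [h1, h4]

lemma normSqSum_mul_one_sub_sq_le (N : ℕ) (x : ℂ) :
    normSqSum N x * ‖1 - x ^ 2‖ ≤ N * (1 + ‖(Chebyshev.T ℂ N).eval x‖ ^ 2) := by
  rw [normSqSum, Finset.sum_mul]
  calc _ ≤ ∑ l ∈ Finset.range N, (1 + ‖(Chebyshev.T ℂ N).eval x‖ ^ 2) :=
        Finset.sum_le_sum fun l hl => norm_U_sq_mul_le x (Finset.mem_range.1 hl)
    _ = _ := by simp [mul_add]

/-- The roots stay at distance of order `|1 - x²| / N` from the real axis. -/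
lemma norm_one_sub_sq_le_of_root (hN : 1 ≤ N) (h : (hybridPoly N).eval x = 0) :
    ‖1 - x ^ 2‖ ≤ 10 * N * -x.im := by
  have h1 := im_mul_of_root h
  have h3 := im_neg_of_root hN h
  have h4 : ‖x‖ ^ 2 * ‖(Chebyshev.U ℂ ((N : ℤ) - 1)).eval x‖ ^ 2 = 1 := by
    rw [← mul_pow, norm_U_of_root h, one_pow]
  have h5 : ‖x‖ ^ 2 * ‖(Chebyshev.T ℂ N).eval x‖ ^ 2 = 1 := by
    rw [← mul_pow, norm_mul_norm_T_of_root h, one_pow]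
  have h6 : ‖x‖ ^ 2 ≤ 2 ^ 2 := by gcongr; exact norm_le_two_of_root hN h
  calc ‖1 - x ^ 2‖ = ‖x‖ ^ 2 * (-x.im *
        (2 * normSqSum N x - ‖(Chebyshev.U ℂ ((N : ℤ) - 1)).eval x‖ ^ 2)) * ‖1 - x ^ 2‖ := by
        rw [h1, h4, one_mul]
    _ ≤ ‖x‖ ^ 2 * (-x.im * (2 * normSqSum N x)) * ‖1 - x ^ 2‖ := by
        gcongr
        exact sub_le_self _ (by positivity)
    _ = ‖x‖ ^ 2 * -x.im * 2 * (normSqSum N x * ‖1 - x ^ 2‖) := by ring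
    _ ≤ ‖x‖ ^ 2 * -x.im * 2 * (N * (1 + ‖(Chebyshev.T ℂ N).eval x‖ ^ 2)) := by
        gcongr ?_ * ?_
        exact normSqSum_mul_one_sub_sq_le N x
    _ = 2 * N * -x.im * (‖x‖ ^ 2 + ‖x‖ ^ 2 * ‖(Chebyshev.T ℂ N).eval x‖ ^ 2) := by ring
    _ ≤ 2 * N * -x.im * (2 ^ 2 + 1) := by
        rw [h5]
        gcongr
    _ = _ := by ring

/-- At most one of three points at mutual distance at least `1` is within `1 / 2` of `x`. -/
lemma one_div_norm_sq_mul_le {x : ℂ} (h0 : x ≠ 0) (h1 : 0 < ‖1 - x ^ 2‖) :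
    1 / (‖x‖ ^ 2 * ‖1 - x ^ 2‖ ^ 2) ≤
      16 * (1 / ‖0 - x‖ ^ 2 + 1 / ‖1 - x‖ ^ 2 + 1 / ‖-1 - x‖ ^ 2) := by
  have hf : ‖1 - x ^ 2‖ = ‖1 - x‖ * ‖-1 - x‖ := by
    rw [← norm_mul, ← norm_neg]; congr 1; ring
  have ha : 0 < ‖x‖ := norm_pos_iff.2 h0
  rw [hf] at h1 ⊢
  have hb : 0 < ‖1 - x‖ := pos_of_mul_pos_left h1 (norm_nonneg _)
  have hc : 0 < ‖-1 - x‖ := pos_of_mul_pos_right h1 (norm_nonneg _)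
  have hab : 1 ≤ ‖x‖ + ‖1 - x‖ := by simpa using norm_add_le x (1 - x)
  have hac : 1 ≤ ‖x‖ + ‖-1 - x‖ := by simpa using norm_add_le x (-1 - x)
  have hbc : 2 ≤ ‖1 - x‖ + ‖-1 - x‖ := by
    have := norm_sub_le (1 - x) (-1 - x)
    norm_num at this
    exact this
  rw [zero_sub, norm_neg]
  have key : ∀ a b c : ℝ, 0 < a → 1 / 2 ≤ b → 1 / 2 ≤ c →
      1 / (a ^ 2 * (b * c) ^ 2) ≤ 16 * (1 / a ^ 2) := by
    intro a b c ha hb hc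
    have hbc : 1 / 4 ≤ b * c := by nlinarith
    rw [mul_one_div, div_le_div_iff₀ (by positivity) (by positivity)]
    have : (1 / 4) ^ 2 ≤ (b * c) ^ 2 := by gcongr
    nlinarith [sq_nonneg a]
  generalize ‖x‖ = a at *
  generalize ‖1 - x‖ = b at *
  generalize ‖-1 - x‖ = c at *
  have pa : 0 < 1 / a ^ 2 := by positivity
  have pb : 0 < 1 / b ^ 2 := by positivity
  have pc : 0 < 1 / c ^ 2 := by positivity
  by_cases h2 : a < 1 / 2
  · linarith [key a b c ha (by linarith) (by linarith)]
  by_cases h3 : b < 1 / 2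
  · have := key b a c hb (by linarith) (by linarith)
    rw [show b ^ 2 * (a * c) ^ 2 = a ^ 2 * (b * c) ^ 2 by ring] at this
    linarith
  · have := key c a b hc (by linarith) (by linarith)
    rw [show c ^ 2 * (a * b) ^ 2 = a ^ 2 * (b * c) ^ 2 by ring] at this
    linarith

lemma normSqSum_le_of_root (hN : 8 ≤ N) (h : (hybridPoly N).eval x = 0) :
    normSqSum N x ≤ 1600 * N ^ 2 * (-x.im / ‖0 - x‖ ^ 2 + -x.im / ‖1 - x‖ ^ 2 +
      -x.im / ‖-1 - x‖ ^ 2) := by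
  have hN1 : 1 ≤ N := by lia
  have h0 := ne_zero_of_root h
  have h1 := norm_one_sub_sq_pos_of_root hN h
  have h2 := normSqSum_mul_le hN1 h
  have h3 := im_neg_of_root hN1 h
  have h4 := norm_one_sub_sq_le_of_root hN1 h
  have hx : 0 < ‖x‖ := norm_pos_iff.2 h0
  calc normSqSum N x ≤ 1 / (‖x‖ ^ 2 * -x.im) := (le_div_iff₀ (by positivity)).2 h2
    _ ≤ (10 * N) ^ 2 * -x.im * (1 / (‖x‖ ^ 2 * ‖1 - x ^ 2‖ ^ 2)) := by
        rw [mul_one_div, div_le_div_iff₀ (by positivity) (by positivity)]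
        have : ‖1 - x ^ 2‖ ^ 2 ≤ (10 * N * -x.im) ^ 2 := by gcongr
        calc 1 * (‖x‖ ^ 2 * ‖1 - x ^ 2‖ ^ 2) ≤ 1 * (‖x‖ ^ 2 * (10 * N * -x.im) ^ 2) := by gcongr
          _ = _ := by ring
    _ ≤ (10 * N) ^ 2 * -x.im *
        (16 * (1 / ‖0 - x‖ ^ 2 + 1 / ‖1 - x‖ ^ 2 + 1 / ‖-1 - x‖ ^ 2)) := by
        gcongr
        exact one_div_norm_sq_mul_le h0 h1
    _ = _ := by ring

end RootBounds

/-! ### Logarithmic derivative -/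

lemma hybridPoly_ne_zero {N : ℕ} (hN : 1 ≤ N) : hybridPoly N ≠ 0 := by
  intro h
  have h1 := eval_hybridPoly N 1
  have hN' : (N : ℝ) ≠ 0 := by positivity
  simp [h] at h1
  exact hN' (by simpa using (congrArg Complex.re h1).symm)

lemma natDegree_hybridPoly_le (N : ℕ) : (hybridPoly N).natDegree ≤ N := by
  refine (natDegree_sub_le _ _).trans (max_le ?_ ((natDegree_C_mul_le _ _).trans ?_))
  · rw [Chebyshev.natDegree_U]
    lia
  · rw [Chebyshev.natDegree_T]
    simp

lemma roots_hybridPoly {N : ℕ} (hN : 1 ≤ N) {x : Fin N → ℂ} (hx : Function.Injective x)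
    (h : ∀ n, (hybridPoly N).eval (x n) = 0) :
    (hybridPoly N).roots = Finset.univ.val.map x := by
  have := roots_eq_of_natDegree_le_card_of_ne_zero (p := hybridPoly N)
    (S := Finset.univ.map ⟨x, hx⟩) (by simpa using h) (by simpa using natDegree_hybridPoly_le N)
    (hybridPoly_ne_zero hN)
  simpa using this

lemma sum_neg_im_div_eq {N : ℕ} (hN : 1 ≤ N) {x : Fin N → ℂ} (hx : Function.Injective x)
    (h : ∀ n, (hybridPoly N).eval (x n) = 0) (t : ℝ) (ht : (hybridPoly N).eval (t : ℂ) ≠ 0) :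
    ∑ n, -(x n).im / ‖t - x n‖ ^ 2 =
      -((derivative (hybridPoly N)).eval (t : ℂ) / (hybridPoly N).eval (t : ℂ)).im := by
  rw [(IsAlgClosed.splits _).eval_derivative_div_eval_of_ne_zero ht, roots_hybridPoly hN hx h]
  simp only [Multiset.map_map, Function.comp_def, ← Finset.sum_eq_multiset_sum, Complex.im_sum,
    ← Finset.sum_neg_distrib]
  refine Finset.sum_congr rfl fun n _ => ?_
  simp [Complex.inv_im, Complex.normSq_eq_norm_sq, neg_div]

lemma sum_neg_im_div_zero {N : ℕ} (hN : 1 ≤ N) {x : Fin N → ℂ} (hx : Function.Injective x)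
    (h : ∀ n, (hybridPoly N).eval (x n) = 0) : ∑ n, -(x n).im / ‖0 - x n‖ ^ 2 = N := by
  have h0 : (hybridPoly N).eval ((0 : ℝ) : ℂ) ≠ 0 := fun h0 => by
    simpa using ne_zero_of_root h0
  have hs := sum_neg_im_div_eq hN hx h 0 h0
  have hd : (derivative (hybridPoly N)).eval ((0 : ℝ) : ℂ) / (hybridPoly N).eval ((0 : ℝ) : ℂ) =
      -(N * Complex.I) := by
    rw [div_eq_iff h0, eval_hybridPoly, eval_derivative_hybridPoly]
    have := natCast_mul_eval_T (0 : ℂ) N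
    simp only [Complex.ofReal_zero]
    linear_combination this - N * (Chebyshev.T ℂ N).eval 0 * Complex.I_sq
  rw [hd] at hs
  simpa using hs

lemma sum_neg_im_div_le_of_sq_eq_one {N : ℕ} (hN : 1 ≤ N) {x : Fin N → ℂ}
    (hx : Function.Injective x) (h : ∀ n, (hybridPoly N).eval (x n) = 0) {t : ℝ}
    (ht : t ^ 2 = 1) : ∑ n, -(x n).im / ‖t - x n‖ ^ 2 ≤ N := by
  have ht' : (t : ℂ) ^ 2 = 1 := by exact_mod_cast ht
  set u := (Chebyshev.U ℂ ((N : ℤ) - 1)).eval (t : ℂ) with hu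
  set τ := (Chebyshev.T ℂ (N : ℤ)).eval (t : ℂ) with hτ
  set d := (derivative (Chebyshev.U ℂ ((N : ℤ) - 1))).eval (t : ℂ) with hd
  have hτ2 : τ ^ 2 = 1 := by
    linear_combination T_sq_sub_mul_U_sq (t : ℂ) N + u ^ 2 * ht'
  have hut : u = t * N * τ := by
    linear_combination -t * natCast_mul_eval_T (t : ℂ) N + (-u - t * d) * ht'
  have hdu : 3 * t * d = (N ^ 2 - 1) * u := by
    have := congrArg (eval (t : ℂ))
      (Chebyshev.one_sub_X_sq_mul_derivative_derivative_U_eq_poly_in_U (R := ℂ) ((N : ℤ) - 1))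
    simp only [eval_mul, eval_sub, eval_add, eval_one, eval_pow, eval_X, eval_ofNat, ht', sub_self,
      zero_mul, eval_intCast, ← hu, ← hd] at this
    push_cast at this
    linear_combination -this
  have hq : (hybridPoly N).eval (t : ℂ) * (u + Complex.I * τ) = N ^ 2 + 1 := by
    rw [eval_hybridPoly, ← hu, ← hτ]
    linear_combination -τ ^ 2 * Complex.I_sq + (N ^ 2 + 1) * hτ2 + (u + t * N * τ) * hut +
      N ^ 2 * τ ^ 2 * ht'
  have hN0 : (0 : ℝ) < N ^ 2 + 1 := by positivity
  have hq0 : (N : ℂ) ^ 2 + 1 ≠ 0 := by exact_mod_cast hN0.ne'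
  have ht0 : (hybridPoly N).eval (t : ℂ) ≠ 0 := left_ne_zero_of_mul (hq ▸ hq0)
  have hr : (derivative (hybridPoly N)).eval (t : ℂ) / (hybridPoly N).eval (t : ℂ) =
      (((t * (N ^ 2 * (N ^ 2 - 1) / 3 + N ^ 2) / (N ^ 2 + 1) : ℝ) : ℂ) +
        ((N * (N ^ 2 - 1) / 3 - N ^ 3) / (N ^ 2 + 1) : ℝ) * Complex.I) := by
    have hd' : d = t * (N ^ 2 - 1) * u / 3 := by
      linear_combination t / 3 * hdu - d * ht'
    have hD : (derivative (hybridPoly N)).eval (t : ℂ) * (u + Complex.I * τ) =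
        t * (N ^ 2 * (N ^ 2 - 1) / 3 + N ^ 2) +
          (N * (N ^ 2 - 1) / 3 - N ^ 3) * Complex.I := by
      rw [eval_derivative_hybridPoly, ← hu, ← hd, hd']
      have hu2 : u ^ 2 = N ^ 2 := by
        linear_combination (u + t * N * τ) * hut + N ^ 2 * τ ^ 2 * ht' + N ^ 2 * hτ2
      have huτ : u * τ = t * N := by linear_combination τ * hut + t * N * hτ2
      linear_combination (t * (N ^ 2 - 1) / 3 - Complex.I * N) * hu2 +
        (Complex.I * t * (N ^ 2 - 1) / 3 - Complex.I ^ 2 * N) * huτ +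
        Complex.I * N * (N ^ 2 - 1) / 3 * ht' - t * N ^ 2 * Complex.I_sq
    rw [div_eq_iff ht0]
    refine mul_right_cancel₀ (right_ne_zero_of_mul (hq ▸ hq0)) ?_
    rw [hD, mul_assoc, hq]
    push_cast
    field_simp
  rw [sum_neg_im_div_eq hN hx h t ht0, hr, Complex.add_im, Complex.ofReal_im,
    Complex.im_ofReal_mul, Complex.I_im, zero_add, mul_one, ← neg_div, div_le_iff₀ hN0]
  have : (1 : ℝ) ≤ N := by exact_mod_cast hN
  nlinarith [mul_nonneg (by linarith : (0 : ℝ) ≤ N - 1) (by linarith : (0 : ℝ) ≤ N + 1)]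


lemma sum_normSqSum_le {N : ℕ} (hN : 8 ≤ N) {x : Fin N → ℂ} (hx : Function.Injective x)
    (h : ∀ n, (hybridPoly N).eval (x n) = 0) : ∑ n, normSqSum N (x n) ≤ 4800 * N ^ 3 := by
  have hN1 : 1 ≤ N := by lia
  have h0 := sum_neg_im_div_zero hN1 hx h
  have h1 := sum_neg_im_div_le_of_sq_eq_one hN1 hx h (t := 1) (by norm_num)
  have h2 := sum_neg_im_div_le_of_sq_eq_one hN1 hx h (t := -1) (by norm_num)
  push_cast at h1 h2
  calc ∑ n, normSqSum N (x n) ≤ ∑ n, 1600 * (N : ℝ) ^ 2 * (-(x n).im / ‖0 - x n‖ ^ 2 +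
        -(x n).im / ‖1 - x n‖ ^ 2 + -(x n).im / ‖-1 - x n‖ ^ 2) :=
        Finset.sum_le_sum fun n _ => normSqSum_le_of_root hN (h n)
    _ ≤ 1600 * (N : ℝ) ^ 2 * (N + N + N) := by
        rw [← Finset.mul_sum, Finset.sum_add_distrib, Finset.sum_add_distrib, h0]
        gcongr
    _ = _ := by ring

/-! ### The eigenvector matrix and its inverse -/

section EigenvectorMatrix

variable {N : ℕ} (x : Fin N → ℂ)

/-- The matrix whose `n`-th column is the eigenvector `(i^l U_l(x_n))_l`. -/
noncomputable def eigenvectorMatrix : Matrix (Fin N) (Fin N) ℂ :=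
  Matrix.of fun l n => Complex.I ^ (l : ℕ) * (Chebyshev.U ℂ ((l : ℕ) : ℤ)).eval (x n)

/-- The matrix of normalized left eigenvectors. -/
noncomputable def leftEigenvectorMatrix : Matrix (Fin N) (Fin N) ℂ :=
  Matrix.of fun n l => (weightedSq N (x n))⁻¹ * (1 - if (l : ℕ) + 1 = N then 1 / 2 else 0) *
    (-Complex.I) ^ (l : ℕ) * (Chebyshev.U ℂ ((l : ℕ) : ℤ)).eval (x n)

lemma frobSq_eigenvectorMatrix :
    frobSq (eigenvectorMatrix x) = ∑ n, normSqSum N (x n) := by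
  rw [frobSq, Finset.sum_comm]
  refine Finset.sum_congr rfl fun n _ => ?_
  simp [eigenvectorMatrix, normSqSum, Finset.sum_range]

lemma leftEigenvectorMatrix_mul_apply (hN : 1 ≤ N) (n m : Fin N) :
    (leftEigenvectorMatrix x * eigenvectorMatrix x) n m = (weightedSq N (x n))⁻¹ *
      (∑ l ∈ Finset.range N, (Chebyshev.U ℂ l).eval (x n) * (Chebyshev.U ℂ l).eval (x m) -
        (Chebyshev.U ℂ ((N : ℤ) - 1)).eval (x n) *
          (Chebyshev.U ℂ ((N : ℤ) - 1)).eval (x m) / 2) := by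
  obtain ⟨k, rfl⟩ := Nat.exists_eq_add_of_le' hN
  have hI (l : ℕ) : (-Complex.I) ^ l * Complex.I ^ l = 1 := by
    rw [← mul_pow, neg_mul, Complex.I_mul_I, neg_neg, one_pow]
  simp only [Matrix.mul_apply, leftEigenvectorMatrix, eigenvectorMatrix, Matrix.of_apply]
  rw [Fin.sum_univ_castSucc, Finset.sum_range_succ, Finset.sum_range]
  push_cast
  rw [add_sub_cancel_right, add_sub_assoc, mul_add, Finset.mul_sum]
  congr 1
  · refine Finset.sum_congr rfl fun l _ => ?_
    simp only [Fin.val_castSucc, if_neg l.2.ne]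
    linear_combination (weightedSq (k + 1) (x n))⁻¹ * (Chebyshev.U ℂ (l : ℕ)).eval (x n) *
      (Chebyshev.U ℂ (l : ℕ)).eval (x m) * hI l
  · simp only [if_true]
    linear_combination (weightedSq (k + 1) (x n))⁻¹ * (Chebyshev.U ℂ (k : ℕ)).eval (x n) *
      (Chebyshev.U ℂ (k : ℕ)).eval (x m) / 2 * hI k

variable {x}

lemma leftEigenvectorMatrix_mul (hN : 8 ≤ N) (hx : Function.Injective x)
    (h : ∀ n, (hybridPoly N).eval (x n) = 0) :
    leftEigenvectorMatrix x * eigenvectorMatrix x = 1 := by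
  ext n m
  rw [leftEigenvectorMatrix_mul_apply x (by lia)]
  rcases eq_or_ne n m with rfl | hnm
  · rw [Matrix.one_apply_eq]
    have h1 := norm_weightedSq_of_root hN (h n)
    have h2 : (8 : ℝ) ≤ N := by exact_mod_cast hN
    have h3 : weightedSq N (x n) ≠ 0 := by
      intro h0
      rw [h0, norm_zero, mul_zero] at h1
      linarith
    simp only [← sq]
    exact inv_mul_cancel₀ h3
  · rw [Matrix.one_apply_ne hnm, sum_mul_eq_zero_of_roots (h n) (h m) (hx.ne hnm), mul_zero]

lemma norm_inv_weightedSq_le {N : ℕ} {x : ℂ} (hN : 8 ≤ N) (h : (hybridPoly N).eval x = 0) :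
    ‖(weightedSq N x)⁻¹‖ ≤ 30 / N := by
  have h1 := norm_weightedSq_of_root hN h
  have h2 : (8 : ℝ) ≤ N := by exact_mod_cast hN
  have h3 : ‖1 - x ^ 2‖ ≤ 5 := by
    have h4 := norm_le_two_of_root (by lia) h
    have h5 : ‖1 - x ^ 2‖ ≤ ‖(1 : ℂ)‖ + ‖x ^ 2‖ := norm_sub_le _ _
    rw [norm_one, norm_pow] at h5
    nlinarith [norm_nonneg x]
  have h4 : (N : ℝ) / 30 ≤ ‖weightedSq N x‖ := by
    nlinarith [norm_nonneg (weightedSq N x)]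
  rw [norm_inv, ← inv_div]
  gcongr

lemma frobSq_leftEigenvectorMatrix_le (hN : 8 ≤ N) (h : ∀ n, (hybridPoly N).eval (x n) = 0) :
    frobSq (leftEigenvectorMatrix x) ≤ (30 / N) ^ 2 * ∑ n, normSqSum N (x n) := by
  rw [frobSq, Finset.mul_sum]
  refine Finset.sum_le_sum fun n _ => ?_
  rw [normSqSum, Finset.sum_range, Finset.mul_sum]
  refine Finset.sum_le_sum fun l _ => ?_
  have hw : ‖(1 - if (l : ℕ) + 1 = N then 1 / 2 else 0 : ℂ)‖ ≤ 1 := by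
    split_ifs <;> norm_num
  simp only [leftEigenvectorMatrix, Matrix.of_apply, norm_mul, norm_pow, norm_neg,
    Complex.norm_I, one_pow, mul_one, mul_pow]
  gcongr
  calc _ ≤ (30 / (N : ℝ)) ^ 2 * 1 ^ 2 := by
        gcongr
        exact norm_inv_weightedSq_le hN (h n)
    _ = _ := by ring

lemma cond2_eigenvectorMatrix_le (hN : 8 ≤ N) (hx : Function.Injective x)
    (h : ∀ n, (hybridPoly N).eval (x n) = 0) :
    cond2 (eigenvectorMatrix x) ≤ 144000 * (N : ℝ) ^ 2 := by
  have hN0 : (0 : ℝ) < N := by positivity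
  rw [cond2, Matrix.inv_eq_left_inv (leftEigenvectorMatrix_mul hN hx h)]
  calc _ ≤ √(∑ n, normSqSum N (x n)) * √((30 / N) ^ 2 * ∑ n, normSqSum N (x n)) := by
        gcongr
        · exact norm_nonneg _
        · exact (spectralNorm2_le_sqrt_frobSq _).trans_eq (by rw [frobSq_eigenvectorMatrix])
        · exact (spectralNorm2_le_sqrt_frobSq _).trans
            (Real.sqrt_le_sqrt (frobSq_leftEigenvectorMatrix_le hN h))
    _ = 30 / N * ∑ n, normSqSum N (x n) := by
        have h0 : 0 ≤ ∑ n, normSqSum N (x n) :=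
          Finset.sum_nonneg fun n _ => Finset.sum_nonneg fun l _ => sq_nonneg _
        rw [Real.sqrt_mul (sq_nonneg _), Real.sqrt_sq (by positivity), mul_left_comm,
          Real.mul_self_sqrt h0]
    _ ≤ 30 / N * (4800 * N ^ 3) := by
        gcongr
        exact sum_normSqSum_le hN hx h
    _ = _ := by
        field_simp
        norm_num

end EigenvectorMatrix

end HybridTime

/-- There is a constant `C > 0` such that, for every `N_t ≥ 8`, the eigenvector matrix
`V` of the hybrid time-discretization matrix (columns `vₙ = (i^l U_l(xₙ))_l`, where
`x₁,…,x_{N_t}` are the distinct roots of `q(x) = U_{N_t-1}(x) - i T_{N_t}(x)`) is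
invertible and satisfies `Cond₂(V) ≤ C N_t²`. -/
theorem hybridT_eigenvectorMatrix_cond_le :
    ∃ C : ℝ, 0 < C ∧ ∀ Nt : ℕ, 8 ≤ Nt → ∀ x : Fin Nt → ℂ,
      Function.Injective x →
      (∀ n, (Polynomial.Chebyshev.U ℂ ((Nt : ℤ) - 1) -
          Polynomial.C Complex.I * Polynomial.Chebyshev.T ℂ (Nt : ℤ)).eval (x n) = 0) →
      (let V : Matrix (Fin Nt) (Fin Nt) ℂ := Matrix.of fun l n =>
          Complex.I ^ (l : ℕ) * (Polynomial.Chebyshev.U ℂ ((l : ℕ) : ℤ)).eval (x n)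
       IsUnit V ∧ cond2 V ≤ C * (Nt : ℝ) ^ 2) := by
  refine ⟨144000, by norm_num, fun N hN x hx h => ?_⟩
  exact ⟨(Matrix.isUnit_iff_isUnit_det _).2 (Matrix.isUnit_det_of_left_inverse
    (HybridTime.leftEigenvectorMatrix_mul hN hx h)),
    HybridTime.cond2_eigenvectorMatrix_le hN hx h⟩
end

section
/- Let A ∈ ℝ^{N_x×N_x} be symmetric positive definite, Δt > 0, N_t ≥ 3, and α ∈ (0,1]. Let λ_1, …, λ_{N_x} be the eigenvalues of D = I_x + (Δt²/2)A (so λ_j > 1) and set θ_j = arctan(√(λ_j² − 1)) ∈ (0, π/2). Define the implicit leap-frog all-at-once matrix 𝐀 = (1/Δt²)(I − S)² ⊗ I_x + (1/2)(I + S²) ⊗ A and the block α-circulant preconditioner P_α = (1/Δt²)(I − S_α)² ⊗ I_x + (1/2)(I + S_α²) ⊗ A. Assume α·e^{i N_t θ_j} ≠ 1 for all j (automatic when α < 1). Then P_α is invertible and the characteristic polynomial of P_α^{-1}𝐀 equals (z − 1)^{(N_t−2)N_x} · ∏_{j=1}^{N_x} (z − 1/(1 − α e^{i N_t θ_j}))·(z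 − 1/(1 − α e^{−i N_t θ_j})); in particular, σ(P_α^{-1}𝐀) = {1} ∪ { 1/(1 − α e^{± i N_t θ_j}) : j = 1,…,N_x }, with the eigenvalue 1 of algebraic multiplicity (N_t−2)N_x. -/
open Matrix Polynomial
open scoped Kronecker

/-- The down-shift matrix `S` (entries `S_{j+1,j} = 1`, 0-based: `S j k = 1` iff `j = k+1`). -/
noncomputable def downShift (N : ℕ) : Matrix (Fin N) (Fin N) ℂ :=
  Matrix.of fun j k : Fin N => if (j : ℕ) = (k : ℕ) + 1 then (1 : ℂ) else 0

/-- The α-shift matrix `S_α = S + α E_{1,N}`, where `E_{1,N}` has a single `1` in the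
top-right corner. -/
noncomputable def downShiftAlpha (N : ℕ) (α : ℂ) : Matrix (Fin N) (Fin N) ℂ :=
  downShift N +
    α • Matrix.of fun j k : Fin N => if (j : ℕ) = 0 ∧ (k : ℕ) + 1 = N then (1 : ℂ) else 0

/-- The matrix `E_{1,N}` with a single `1` in the top-right corner. -/
def topRightUnit (N : ℕ) : Matrix (Fin N) (Fin N) ℂ :=
  Matrix.of fun j k : Fin N => if (j : ℕ) = 0 ∧ (k : ℕ) + 1 = N then (1 : ℂ) else 0

lemma downShiftAlpha_eq (N : ℕ) (α : ℂ) :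
    downShiftAlpha N α = downShift N + α • topRightUnit N := rfl

lemma downShiftAlpha_zero (N : ℕ) : downShiftAlpha N 0 = downShift N := by
  simp [downShiftAlpha_eq]

lemma topRightUnit_mul_self {N : ℕ} (hN : 2 ≤ N) : topRightUnit N * topRightUnit N = 0 := by
  ext i j
  rw [Matrix.mul_apply]
  refine Finset.sum_eq_zero fun k _ => ?_
  simp only [topRightUnit, Matrix.of_apply]
  split_ifs <;> first | omega | simp

/-- Since `E_{1,N}` squares to zero, the square of `S_α` is affine in `α`. -/
lemma downShiftAlpha_sq {N : ℕ} (hN : 2 ≤ N) (α : ℂ) :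
    downShiftAlpha N α ^ 2 = downShift N ^ 2 +
      α • (downShift N * topRightUnit N + topRightUnit N * downShift N) := by
  rw [downShiftAlpha_eq, sq, sq, add_mul, mul_add, mul_add, smul_mul_smul_comm,
    topRightUnit_mul_self hN, smul_mul_assoc, mul_smul_comm, smul_zero, smul_add]
  abel

lemma det_smul_one_sub_downShift (N : ℕ) (μ : ℂ) :
    (μ • (1 : Matrix (Fin N) (Fin N) ℂ) - downShift N).det = μ ^ N := by
  rw [Matrix.det_of_isLowerTriangular]
  · simp [downShift]
  · intro i j hij
    have hij' : i < j := hij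
    have h : (i : ℕ) ≠ (j : ℕ) + 1 := by have := Fin.lt_def.mp hij'; omega
    simp [downShift, hij'.ne, h]

/-- The first column of `(μ - S)⁻¹` is geometric. -/
lemma smul_one_sub_downShift_mulVec (N : ℕ) {μ : ℂ} (hμ : μ ≠ 0) :
    (μ • (1 : Matrix (Fin (N + 1)) (Fin (N + 1)) ℂ) - downShift (N + 1)) *ᵥ
      (fun k => μ⁻¹ ^ ((k : ℕ) + 1)) = Pi.single 0 1 := by
  ext i
  rw [Matrix.sub_mulVec, Matrix.smul_mulVec, Matrix.one_mulVec, Pi.sub_apply, Pi.smul_apply,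
    Matrix.mulVec, dotProduct]
  induction i using Fin.cases with
  | zero => simp [downShift, hμ]
  | succ i =>
    rw [Finset.sum_eq_single i.castSucc]
    · simp [downShift, pow_succ]
      field_simp
      simp
    · intro b _ hb
      have : (i : ℕ) ≠ b := fun h => hb (Fin.ext h.symm)
      simp [downShift, this]
    · simp

/-- The characteristic polynomial of `S_α`, away from `0`. -/
lemma det_smul_one_sub_downShiftAlpha {N : ℕ} (hN : 1 ≤ N) {μ : ℂ} (hμ : μ ≠ 0) (α : ℂ) :
    (μ • (1 : Matrix (Fin N) (Fin N) ℂ) - downShiftAlpha N α).det = μ ^ N - α := by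
  obtain ⟨N, rfl⟩ : ∃ n, N = n + 1 := ⟨N - 1, by omega⟩
  have hdet : IsUnit (μ • (1 : Matrix (Fin (N + 1)) (Fin (N + 1)) ℂ) - downShift (N + 1)).det := by
    rw [det_smul_one_sub_downShift]
    exact (pow_ne_zero _ hμ).isUnit
  have hdecomp : μ • (1 : Matrix (Fin (N + 1)) (Fin (N + 1)) ℂ) - downShiftAlpha (N + 1) α =
      (μ • 1 - downShift (N + 1)) +
        replicateCol Unit (Pi.single 0 (-α) : Fin (N + 1) → ℂ) *
          replicateRow Unit (Pi.single (Fin.last N) 1 : Fin (N + 1) → ℂ) := by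
    rw [downShiftAlpha_eq, sub_add_eq_sub_sub, sub_eq_add_neg]
    congr 1
    ext i j
    simp only [topRightUnit, Matrix.neg_apply, Matrix.smul_apply, Matrix.of_apply, Matrix.mul_apply,
      replicateCol_apply, replicateRow_apply, Pi.single_apply, Fin.ext_iff, Fin.val_zero,
      Fin.val_last, add_left_inj]
    by_cases h1 : (i : ℕ) = 0 <;> by_cases h2 : (j : ℕ) = N <;> simp [h1, h2]
  have hinv : (μ • (1 : Matrix (Fin (N + 1)) (Fin (N + 1)) ℂ) - downShift (N + 1))⁻¹ *ᵥ
      (Pi.single 0 (-α)) = fun k : Fin (N + 1) => -α * μ⁻¹ ^ ((k : ℕ) + 1) := by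
    have : (Pi.single 0 (-α) : Fin (N + 1) → ℂ) = (-α) • Pi.single 0 1 := by
      rw [← Pi.single_smul, smul_eq_mul, mul_one]
    rw [this, Matrix.mulVec_smul, ← smul_one_sub_downShift_mulVec N hμ, Matrix.mulVec_mulVec,
      Matrix.nonsing_inv_mul _ hdet, Matrix.one_mulVec]
    rfl
  rw [hdecomp, det_add_replicateCol_mul_replicateRow hdet, det_smul_one_sub_downShift,
    Matrix.mul_assoc, ← Matrix.replicateCol_mulVec, hinv, Matrix.det_unique]
  simp [Matrix.mul_apply, Pi.single_apply]
  field_simp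
  ring

/-- Determinant of a quadratic polynomial in `S_α` whose roots have product `1` and sum `2 / d`. -/
lemma det_quadratic_downShiftAlpha {N : ℕ} (hN : 1 ≤ N) (α : ℂ) {d μ ν : ℂ}
    (hprod : μ * ν = 1) (hsum : d * (μ + ν) = 2) :
    (d • (1 + downShiftAlpha N α ^ 2) + (-2 : ℂ) • downShiftAlpha N α).det =
      d ^ N * ((1 - α * μ ^ N) * (1 - α * ν ^ N)) := by
  have hfac : d • (1 + downShiftAlpha N α ^ 2) + (-2 : ℂ) • downShiftAlpha N α =
      d • ((μ • 1 - downShiftAlpha N α) * (ν • 1 - downShiftAlpha N α)) := by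
    rw [sub_mul, mul_sub, mul_sub, smul_mul_smul_comm, hprod, mul_one, one_smul, smul_mul_assoc,
      mul_smul_comm, one_mul, mul_one, ← sq, ← hsum]
    module
  have hpow : μ ^ N * ν ^ N = 1 := by rw [← mul_pow, hprod, one_pow]
  rw [hfac, Matrix.det_smul, Matrix.det_mul,
    det_smul_one_sub_downShiftAlpha hN (left_ne_zero_of_mul_eq_one hprod),
    det_smul_one_sub_downShiftAlpha hN (right_ne_zero_of_mul_eq_one hprod), Fintype.card_fin]
  linear_combination d ^ N * (1 - α ^ 2) * hpow

section Kronecker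

variable {m n : Type*} [Fintype m] [DecidableEq m] [Fintype n] [DecidableEq n]

lemma det_kronecker_diagonal_add_kronecker_one (M K : Matrix m m ℂ) (d : n → ℂ) :
    (M ⊗ₖ diagonal d + K ⊗ₖ (1 : Matrix n n ℂ)).det = ∏ j, (d j • M + K).det := by
  rw [← Matrix.det_blockDiagonal]
  congr 1
  ext ⟨i, k⟩ ⟨j, l⟩
  by_cases h : k = l <;>
    simp [Matrix.kroneckerMap_apply, Matrix.blockDiagonal_apply, h, mul_comm]

/-- Block diagonalization of `M ⊗ B + K ⊗ 1` for Hermitian `B`, at the level of determinants. -/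
lemma det_kronecker_add_kronecker_one {B : Matrix n n ℂ} (hB : B.IsHermitian)
    (M K : Matrix m m ℂ) :
    (M ⊗ₖ B + K ⊗ₖ (1 : Matrix n n ℂ)).det = ∏ j, ((hB.eigenvalues j : ℂ) • M + K).det := by
  have hU : (hB.eigenvectorUnitary : Matrix n n ℂ) * star (hB.eigenvectorUnitary : Matrix n n ℂ)
      = 1 := Unitary.coe_mul_star_self _
  have hspec : B = (hB.eigenvectorUnitary : Matrix n n ℂ) *
      diagonal (fun j => (hB.eigenvalues j : ℂ)) *
      star (hB.eigenvectorUnitary : Matrix n n ℂ) := by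
    conv_lhs => rw [hB.spectral_theorem]
    rfl
  set U : Matrix n n ℂ := (hB.eigenvectorUnitary : Matrix n n ℂ)
  set d : n → ℂ := fun j => (hB.eigenvalues j : ℂ)
  have hconj : M ⊗ₖ B + K ⊗ₖ (1 : Matrix n n ℂ) =
      ((1 : Matrix m m ℂ) ⊗ₖ U) * (M ⊗ₖ diagonal d + K ⊗ₖ 1) * ((1 : Matrix m m ℂ) ⊗ₖ star U) := by
    rw [mul_add, add_mul, ← Matrix.mul_kronecker_mul, ← Matrix.mul_kronecker_mul,
      ← Matrix.mul_kronecker_mul, ← Matrix.mul_kronecker_mul]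
    simp only [one_mul, mul_one, hU, ← hspec]
  have hdet : ((1 : Matrix m m ℂ) ⊗ₖ U).det * ((1 : Matrix m m ℂ) ⊗ₖ star U).det = 1 := by
    rw [← Matrix.det_mul, ← Matrix.mul_kronecker_mul, hU, mul_one, Matrix.one_kronecker_one,
      Matrix.det_one]
  rw [hconj, Matrix.det_mul, Matrix.det_mul, mul_right_comm, hdet, one_mul,
    det_kronecker_diagonal_add_kronecker_one]

end Kronecker

/-- Products over the eigenvalues may be computed with any listing of them. -/
lemma prod_eigenvalues_eq {n : Type*} [Fintype n] [DecidableEq n] {B : Matrix n n ℂ}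
    (hB : B.IsHermitian) {d : n → ℂ} (hd : B.charpoly = ∏ j, (X - C (d j))) (f : ℂ → ℂ) :
    ∏ j, f (hB.eigenvalues j : ℂ) = ∏ j, f (d j) := by
  have h : Finset.univ.val.map (fun j => (hB.eigenvalues j : ℂ)) = Finset.univ.val.map d := by
    have hroots : ∀ e : n → ℂ, (∏ j, (X - C (e j))).roots = Finset.univ.val.map e := by
      intro e
      have := Polynomial.roots_multiset_prod_X_sub_C (Finset.univ.val.map e)
      rwa [Multiset.map_map] at this
    rw [← hroots, ← hroots, ← hd, hB.charpoly_eq]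
    rfl
  have := congrArg (fun s => (s.map f).prod) h
  simpa only [Multiset.map_map] using! this

/-- The all-at-once leap-frog matrix with `S_α` in place of the shift, where `c = Δt`. -/
noncomputable def leapfrogMatrix (Nt : ℕ) {n : Type*} [DecidableEq n] (B : Matrix n n ℂ)
    (c α : ℂ) : Matrix (Fin Nt × n) (Fin Nt × n) ℂ :=
  (1 / c ^ 2) • (((1 - downShiftAlpha Nt α) ^ 2) ⊗ₖ (1 : Matrix n n ℂ)) +
    (1 / 2 : ℂ) • ((1 + downShiftAlpha Nt α ^ 2) ⊗ₖ B)

section Leapfrog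

variable {n : Type*} [DecidableEq n]

/-- The preconditioned pencil is again a leap-frog matrix, up to a scalar. -/
lemma smul_leapfrogMatrix_sub {Nt : ℕ} (hNt : 2 ≤ Nt) (B : Matrix n n ℂ) (c α : ℂ) {z : ℂ}
    (hz : z - 1 ≠ 0) :
    z • leapfrogMatrix Nt B c α - leapfrogMatrix Nt B c 0 =
      (z - 1) • leapfrogMatrix Nt B c (z * α / (z - 1)) := by
  have hsq : ∀ β : ℂ, (1 - downShiftAlpha Nt β) ^ 2 =
      1 - (2 : ℂ) • downShiftAlpha Nt β + downShiftAlpha Nt β ^ 2 := by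
    intro β
    rw [sq, sq, sub_mul, mul_sub, mul_sub, one_mul, one_mul, mul_one, two_smul]
    abel
  have haff : ∀ β : ℂ, leapfrogMatrix Nt B c β =
      leapfrogMatrix Nt B c 0 + β • (leapfrogMatrix Nt B c 1 - leapfrogMatrix Nt B c 0) := by
    intro β
    ext ⟨i, k⟩ ⟨j, l⟩
    simp only [leapfrogMatrix, hsq, downShiftAlpha_sq hNt]
    simp only [downShiftAlpha_eq, Matrix.add_apply, Matrix.sub_apply, Matrix.smul_apply, Matrix.kroneckerMap_apply, smul_eq_mul]
    ring
  rw [haff α, haff (z * α / (z - 1)), smul_add (z - 1), smul_smul (z - 1), mul_div_cancel₀ _ hz]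
  module

lemma leapfrogMatrix_eq (Nt : ℕ) (B : Matrix n n ℂ) {c : ℂ} (hc : c ≠ 0) (α : ℂ) :
    leapfrogMatrix Nt B c α = (1 / c ^ 2) •
      ((1 + downShiftAlpha Nt α ^ 2) ⊗ₖ (1 + (c ^ 2 / 2) • B) +
        ((-2 : ℂ) • downShiftAlpha Nt α) ⊗ₖ (1 : Matrix n n ℂ)) := by
  have hsq : (1 - downShiftAlpha Nt α) ^ 2 =
      (1 + downShiftAlpha Nt α ^ 2) + (-2 : ℂ) • downShiftAlpha Nt α := by
    rw [sq, sq, sub_mul, mul_sub, mul_sub, one_mul, one_mul, mul_one, neg_smul, two_smul]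
    abel
  rw [leapfrogMatrix, hsq]
  ext ⟨i, k⟩ ⟨j, l⟩
  simp only [Matrix.add_apply, Matrix.smul_apply, Matrix.kroneckerMap_apply, smul_eq_mul]
  field_simp
  ring

variable [Fintype n]

/-- Determinant of the leap-frog matrix in terms of the roots `μ j`, `ν j` of
`d_j x² - 2 x + d_j`, where the `d_j` are the eigenvalues of `1 + (c² / 2) B`. -/
lemma det_leapfrogMatrix {Nt : ℕ} (hNt : 1 ≤ Nt) {B : Matrix n n ℂ} {c : ℂ} (hc : c ≠ 0)
    (hB : (1 + (c ^ 2 / 2) • B).IsHermitian) {d μ ν : n → ℂ}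
    (hd : (1 + (c ^ 2 / 2) • B).charpoly = ∏ j, (X - C (d j)))
    (hprod : ∀ j, μ j * ν j = 1) (hsum : ∀ j, d j * (μ j + ν j) = 2) (α : ℂ) :
    (leapfrogMatrix Nt B c α).det = (1 / c ^ 2) ^ (Nt * Fintype.card n) * (∏ j, d j ^ Nt) *
      ∏ j, ((1 - α * μ j ^ Nt) * (1 - α * ν j ^ Nt)) := by
  have heig := prod_eigenvalues_eq hB hd fun x =>
    (x • (1 + downShiftAlpha Nt α ^ 2) + (-2 : ℂ) • downShiftAlpha Nt α).det
  rw [leapfrogMatrix_eq Nt B hc, Matrix.det_smul, det_kronecker_add_kronecker_one hB,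
    heig,
    Finset.prod_congr rfl fun j _ => det_quadratic_downShiftAlpha hNt α (hprod j) (hsum j),
    Finset.prod_mul_distrib, Fintype.card_prod, Fintype.card_fin, mul_assoc]

/-- Characteristic polynomial of the preconditioned leap-frog matrix. -/
lemma charpoly_leapfrogMatrix_inv_mul {Nt : ℕ} (hNt : 2 ≤ Nt) {B : Matrix n n ℂ} {c : ℂ}
    (hc : c ≠ 0) (hB : (1 + (c ^ 2 / 2) • B).IsHermitian) {d μ ν : n → ℂ}
    (hd : (1 + (c ^ 2 / 2) • B).charpoly = ∏ j, (X - C (d j)))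
    (hprod : ∀ j, μ j * ν j = 1) (hsum : ∀ j, d j * (μ j + ν j) = 2) {α : ℂ}
    (hμ : ∀ j, 1 - α * μ j ^ Nt ≠ 0) (hν : ∀ j, 1 - α * ν j ^ Nt ≠ 0) :
    IsUnit (leapfrogMatrix Nt B c α) ∧
      ((leapfrogMatrix Nt B c α)⁻¹ * leapfrogMatrix Nt B c 0).charpoly =
        (X - 1) ^ ((Nt - 2) * Fintype.card n) *
          ∏ j, ((X - C (1 / (1 - α * μ j ^ Nt))) * (X - C (1 / (1 - α * ν j ^ Nt)))) := by
  have hdet := det_leapfrogMatrix (by omega : 1 ≤ Nt) hc hB hd hprod hsum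
  have hd0 : ∀ j, d j ≠ 0 := fun j h => by simpa [h] using hsum j
  have hunit : IsUnit (leapfrogMatrix Nt B c α).det := by
    rw [hdet, isUnit_iff_ne_zero]
    refine mul_ne_zero (mul_ne_zero (pow_ne_zero _ (one_div_ne_zero (pow_ne_zero 2 hc))) ?_) ?_
    · exact Finset.prod_ne_zero_iff.mpr fun j _ => pow_ne_zero _ (hd0 j)
    · exact Finset.prod_ne_zero_iff.mpr fun j _ => mul_ne_zero (hμ j) (hν j)
  refine ⟨(Matrix.isUnit_iff_isUnit_det _).mpr hunit, ?_⟩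
  refine Polynomial.eq_of_infinite_eval_eq _ _
    (Set.Infinite.mono ?_ (Set.finite_singleton (1 : ℂ)).infinite_compl)
  intro z hz
  have hz1 : z - 1 ≠ 0 := sub_ne_zero.mpr hz
  have hpencil : leapfrogMatrix Nt B c α *
      (scalar _ z - (leapfrogMatrix Nt B c α)⁻¹ * leapfrogMatrix Nt B c 0) =
      (z - 1) • leapfrogMatrix Nt B c (z * α / (z - 1)) := by
    rw [← smul_leapfrogMatrix_sub hNt B c α hz1, mul_sub, ← mul_assoc,
      Matrix.mul_nonsing_inv _ hunit, one_mul, Matrix.scalar_apply, ← Matrix.smul_one_eq_diagonal,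
      mul_smul_comm, mul_one]
  have hfactor : ∀ w : ℂ, 1 - α * w ≠ 0 →
      (z - 1) * (1 - z * α / (z - 1) * w) = (1 - α * w) * (z - 1 / (1 - α * w)) := by
    intro w hw
    field_simp
    ring
  have key := congrArg Matrix.det hpencil
  rw [Matrix.det_mul, Matrix.det_smul, hdet, hdet, ← Matrix.eval_charpoly, Fintype.card_prod,
    Fintype.card_fin] at key
  have hexp : (z - 1) ^ (Nt * Fintype.card n) =
      (z - 1) ^ ((Nt - 2) * Fintype.card n) * ∏ _j : n, ((z - 1) * (z - 1)) := by
    rw [Finset.prod_const, Finset.card_univ, ← sq, ← pow_mul, ← pow_add, ← add_mul,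
      Nat.sub_add_cancel hNt]
  have hprods : (∏ _j : n, ((z - 1) * (z - 1))) *
      ∏ j, ((1 - z * α / (z - 1) * μ j ^ Nt) * (1 - z * α / (z - 1) * ν j ^ Nt)) =
      (∏ j, ((1 - α * μ j ^ Nt) * (1 - α * ν j ^ Nt))) *
        ∏ j, ((z - 1 / (1 - α * μ j ^ Nt)) * (z - 1 / (1 - α * ν j ^ Nt))) := by
    rw [← Finset.prod_mul_distrib, ← Finset.prod_mul_distrib]
    refine Finset.prod_congr rfl fun j _ => ?_
    rw [mul_mul_mul_comm, hfactor _ (hμ j), hfactor _ (hν j), mul_mul_mul_comm]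
  rw [hexp] at key
  rw [hdet] at hunit
  refine mul_left_cancel₀ hunit.ne_zero (key.trans ?_)
  simp only [eval_mul, eval_pow, eval_sub, eval_X, eval_one, eval_C, eval_prod]
  linear_combination (z - 1) ^ ((Nt - 2) * Fintype.card n) *
    ((1 / c ^ 2) ^ (Nt * Fintype.card n) * ∏ j, d j ^ Nt) * hprods

end Leapfrog

/-- For `θ = arctan √(λ² - 1)` the numbers `e^{±iθ}` sum to `2 / λ`. -/
lemma mul_exp_add_exp_neg_arctan {l : ℝ} (hl : 1 < l) :
    (l : ℂ) * (Complex.exp (Complex.I * (Real.arctan (Real.sqrt (l ^ 2 - 1)) : ℝ)) +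
      Complex.exp (-(Complex.I * (Real.arctan (Real.sqrt (l ^ 2 - 1)) : ℝ)))) = 2 := by
  have hcos : l * Real.cos (Real.arctan (Real.sqrt (l ^ 2 - 1))) = 1 := by
    rw [Real.cos_arctan, Real.sq_sqrt (by nlinarith), add_sub_cancel, Real.sqrt_sq (by linarith)]
    field_simp
  have h := Complex.two_cos (Real.arctan (Real.sqrt (l ^ 2 - 1)) : ℝ)
  rw [mul_comm Complex.I, ← neg_mul, ← h, ← Complex.ofReal_cos, mul_left_comm,
    ← Complex.ofReal_mul, hcos]
  simp

/-- Spectrum of the ParaDiag preconditioned implicit leap-frog all-at-once matrix: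
the characteristic polynomial of `P_α⁻¹ 𝐀` is
`(z-1)^{(N_t-2)N_x} ∏_j (z - 1/(1-αe^{iN_tθ_j}))(z - 1/(1-αe^{-iN_tθ_j}))`, so
`σ(P_α⁻¹𝐀) = {1} ∪ {1/(1-αe^{±iN_tθ_j})}`, with eigenvalue `1` of algebraic
multiplicity `(N_t-2)N_x`. -/
theorem paraDiagII_leapfrog_charpoly (Nx Nt : ℕ) (hNx : 1 ≤ Nx) (hNt : 3 ≤ Nt)
    (A : Matrix (Fin Nx) (Fin Nx) ℝ) (hA : A.PosDef)
    (Δt : ℝ) (hΔt : 0 < Δt) (α : ℝ) (hα : α ∈ Set.Ioc (0 : ℝ) 1)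
    (lam : Fin Nx → ℝ)
    (hlam : ((1 : Matrix (Fin Nx) (Fin Nx) ℝ) + (Δt ^ 2 / 2) • A).charpoly =
      ∏ j, (X - C (lam j)))
    (hlam1 : ∀ j, 1 < lam j)
    (θ : Fin Nx → ℝ) (hθ : ∀ j, θ j = Real.arctan (Real.sqrt ((lam j) ^ 2 - 1)))
    (hne : ∀ j : Fin Nx, (α : ℂ) * Complex.exp (Complex.I * Nt * (θ j : ℝ)) ≠ 1) :
    let Ix : Matrix (Fin Nx) (Fin Nx) ℂ := 1
    let Ac : Matrix (Fin Nx) (Fin Nx) ℂ := A.map Complex.ofReal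
    let AA := (1 / (Δt : ℂ) ^ 2) • (((1 - downShift Nt) ^ 2) ⊗ₖ Ix) +
              (1 / 2 : ℂ) • ((1 + downShift Nt ^ 2) ⊗ₖ Ac)
    let Pα := (1 / (Δt : ℂ) ^ 2) • (((1 - downShiftAlpha Nt (α : ℂ)) ^ 2) ⊗ₖ Ix) +
              (1 / 2 : ℂ) • ((1 + downShiftAlpha Nt (α : ℂ) ^ 2) ⊗ₖ Ac)
    IsUnit Pα ∧
      (Pα⁻¹ * AA).charpoly =
        (X - 1) ^ ((Nt - 2) * Nx) *
          ∏ j : Fin Nx,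
            ((X - C (1 / (1 - (α : ℂ) * Complex.exp (Complex.I * Nt * (θ j : ℝ))))) *
             (X - C (1 / (1 - (α : ℂ) * Complex.exp (-(Complex.I * Nt * (θ j : ℝ))))))) ∧
      spectrum ℂ (Pα⁻¹ * AA) =
        {1} ∪ {z : ℂ | ∃ j : Fin Nx,
          z = 1 / (1 - (α : ℂ) * Complex.exp (Complex.I * Nt * (θ j : ℝ))) ∨
          z = 1 / (1 - (α : ℂ) * Complex.exp (-(Complex.I * Nt * (θ j : ℝ))))} := by
  intro Ix Ac AA Pα
  have hc : (Δt : ℂ) ≠ 0 := Complex.ofReal_ne_zero.mpr hΔt.ne'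
  have hmap : 1 + ((Δt : ℂ) ^ 2 / 2) • Ac =
      ((1 : Matrix (Fin Nx) (Fin Nx) ℝ) + (Δt ^ 2 / 2) • A).map Complex.ofRealHom := by
    ext i j
    by_cases h : i = j <;> simp [Ac, h]
  have hB : (1 + ((Δt : ℂ) ^ 2 / 2) • Ac).IsHermitian := by
    rw [hmap]
    refine Matrix.IsHermitian.map ?_ _ fun x => by simp
    exact Matrix.isHermitian_one.add (hA.isHermitian.smul (IsSelfAdjoint.all _))
  have hd : (1 + ((Δt : ℂ) ^ 2 / 2) • Ac).charpoly = ∏ j, (X - C (lam j : ℂ)) := by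
    rw [hmap, Matrix.charpoly_map, hlam, Polynomial.map_prod]
    simp
  have hpow : ∀ j, Complex.exp (Complex.I * (θ j : ℝ)) ^ Nt =
      Complex.exp (Complex.I * Nt * (θ j : ℝ)) := by
    intro j
    rw [← Complex.exp_nat_mul]
    ring_nf
  have hpow' : ∀ j, Complex.exp (-(Complex.I * (θ j : ℝ))) ^ Nt =
      Complex.exp (-(Complex.I * Nt * (θ j : ℝ))) := by
    intro j
    rw [← Complex.exp_nat_mul]
    ring_nf
  have hμ : ∀ j, 1 - (α : ℂ) * Complex.exp (Complex.I * (θ j : ℝ)) ^ Nt ≠ 0 := by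
    intro j
    rw [hpow]
    exact sub_ne_zero.mpr (hne j).symm
  have hν : ∀ j, 1 - (α : ℂ) * Complex.exp (-(Complex.I * (θ j : ℝ))) ^ Nt ≠ 0 := by
    intro j h
    refine hμ j ?_
    have h' := congrArg (starRingEnd ℂ) h
    simpa [← Complex.exp_conj] using h'
  obtain ⟨hunit, hchar⟩ := charpoly_leapfrogMatrix_inv_mul (by omega : 2 ≤ Nt) hc hB hd
    (fun j => by rw [← Complex.exp_add, add_neg_cancel, Complex.exp_zero])
    (fun j => by rw [hθ j]; exact mul_exp_add_exp_neg_arctan (hlam1 j)) hμ hν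
  have hAA : leapfrogMatrix Nt Ac (Δt : ℂ) 0 = AA := by
    rw [leapfrogMatrix, downShiftAlpha_zero]
  change IsUnit Pα at hunit
  change (Pα⁻¹ * _).charpoly = _ at hchar
  simp only [hAA, hpow, hpow', Fintype.card_fin] at hchar
  refine ⟨hunit, hchar, ?_⟩
  ext z
  have hexp : (Nt - 2) * Nx ≠ 0 := Nat.mul_ne_zero (by omega) (by omega)
  rw [Matrix.mem_spectrum_iff_isRoot_charpoly, hchar, Polynomial.IsRoot.def]
  simp only [eval_mul, eval_pow, eval_sub, eval_X, eval_one, eval_C, eval_prod, mul_eq_zero,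
    pow_eq_zero_iff hexp, Finset.prod_eq_zero_iff, Finset.mem_univ, true_and, sub_eq_zero,
    Set.mem_union, Set.mem_singleton_iff, Set.mem_ofPred_eq]
end
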